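/- arXiv:1111.2212 — 2 statements merged into one kernel-verified Lean document; each statement's English description precedes it below -/
import Mathlib

section
/- Let n be a non-negative integer and let k ∈ GL₂(F) be such that both k and k^{-1} have entries k₁₁, k₂₂ ∈ o_F, k₁₂ ∈ p_F^{-n}, k₂₁ ∈ p_F^n. Then for every s ∈ ℂ with Re(s) < 1, z(1−s, k, Φ̂_n) = q^{−2n(s−1/2)}·L_E(1−s, 1). -/
set_option autoImplicit false

open MeasureTheory Matrix

noncomputable section

/-- The zeta integral `z(s, g, Φ) = ∫_{F^×} (gΦ)(0,r) |r|_E^s d^×r`, where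
`|r|_E = |r|_F^2` and `d^×r` is the measure `μ`. -/
def zInt {F : Type} [Field F] [MeasurableSpace F] (μ : Measure F)
    (absF : F → ℝ) (s : ℂ) (g : Matrix (Fin 2) (Fin 2) F) (Φ : F × F → ℂ) : ℂ :=
  ∫ r, Φ (r * g 1 0, r * g 1 1) * Complex.ofReal (absF r ^ 2) ^ s ∂μ

/-- `Φ_n`, the characteristic function of `p_F^n ⊕ o_F`. -/
def PhiN {F : Type} [Field F] (q : ℝ) (absF : F → ℝ) (n : ℤ) : F × F → ℂ :=
  fun p => if absF p.1 ≤ q ^ (-n) ∧ absF p.2 ≤ 1 then 1 else 0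

/-- `L_E(s, 1) = 1 / (1 - q^{-2s})`. -/
def LEfac (q : ℝ) (s : ℂ) : ℂ := 1 / (1 - (q : ℂ) ^ (-2 * s))

/-- The Fourier transform `Φ̂(x,y) = ∫_{F²} Φ(u,v) ψ(yu - xv) du dv`. -/
def FHat {F : Type} [Field F] [MeasurableSpace F] (μa : Measure F)
    (ψF : F → ℂ) (Φ : F × F → ℂ) : F × F → ℂ :=
  fun p => ∫ w : F × F, Φ w * ψF (p.2 * w.1 - p.1 * w.2) ∂(μa.prod μa)

/-- The second Fourier transform `Φ*(x,y) = ∫_{F²} Φ(u,v) ψ(yu + xv) du dv`. -/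
def PhiSt {F : Type} [Field F] [MeasurableSpace F] (μa : Measure F)
    (ψF : F → ℂ) (Φ : F × F → ℂ) : F × F → ℂ :=
  fun p => ∫ w : F × F, Φ w * ψF (p.2 * w.1 + p.1 * w.2) ∂(μa.prod μa)

/-- Powers computation. -/
theorem aux_val (q : ℝ) (hq : 1 < q) (z : ℂ) (n j : ℕ) :
    Complex.ofReal ((q ^ ((n : ℤ) - j)) ^ 2) ^ z
      = (q : ℂ) ^ (2 * (n : ℂ) * z) * ((q : ℂ) ^ (-2 * z)) ^ j := by
  have hq0 : (0 : ℝ) < q := by linarith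
  have hqc : (q : ℂ) ≠ 0 := by exact_mod_cast hq0.ne'
  have h1 : ((q ^ ((n : ℤ) - j)) ^ 2 : ℝ) = Real.exp (Real.log q * (2 * ((n : ℝ) - j))) := by
    rw [← Real.rpow_def_of_pos hq0, ← Real.rpow_intCast, ← Real.rpow_natCast, ← Real.rpow_mul hq0.le]
    push_cast
    ring_nf
  rw [h1, Complex.ofReal_exp, Complex.cpow_def_of_ne_zero (Complex.exp_ne_zero _),
    ← Complex.ofReal_exp, ← Complex.ofReal_log (Real.exp_pos _).le, Real.log_exp,
    Complex.cpow_def_of_ne_zero hqc, Complex.cpow_def_of_ne_zero hqc, ← Complex.exp_nat_mul,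
    ← Complex.exp_add, ← Complex.ofReal_log hq0.le]
  push_cast
  ring_nf

/-- The integral of `|r|^{2z}` over `|r| ≤ q^n`. -/
theorem aux_int (F : Type) [Field F]
    (q : ℝ) (hq : 1 < q) (absF : F → ℝ)
    (habsF0 : ∀ x : F, absF x = 0 ↔ x = 0)
    (hvalF : ∀ x : F, x ≠ 0 → ∃ m : ℤ, absF x = q ^ m)
    [MeasurableSpace F] (habsFmeas : Measurable absF)
    (μ : Measure F) (hμ : ∀ m : ℤ, μ {x : F | absF x = q ^ m} = 1)
    (n : ℕ) (z : ℂ) (hz : 0 < z.re) :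
    ∫ r, (if absF r ≤ q ^ (n : ℤ) then 1 else 0) * Complex.ofReal (absF r ^ 2) ^ z ∂μ
      = (q : ℂ) ^ (2 * (n : ℂ) * z) * (1 / (1 - (q : ℂ) ^ (-2 * z))) := by
  have hq0 : (0 : ℝ) < q := by linarith
  have hz0 : z ≠ 0 := by rintro rfl; simp at hz
  set w : ℂ := (q : ℂ) ^ (-2 * z) with hw
  set C : ℂ := (q : ℂ) ^ (2 * (n : ℂ) * z) with hC
  have hwn : ‖w‖ < 1 := by
    rw [hw, Complex.norm_cpow_eq_rpow_re_of_pos hq0]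
    apply Real.rpow_lt_one_of_one_lt_of_neg hq
    simp; linarith
  let f : ℕ → F → ℂ := fun j => Set.indicator {x : F | absF x = q ^ ((n : ℤ) - j)} (fun _ => C * w ^ j)
  have hmeas : ∀ m : ℤ, MeasurableSet {x : F | absF x = q ^ m} := fun m =>
    habsFmeas (measurableSet_singleton _)
  have hfi : ∀ j, Integrable (f j) μ := by
    intro j
    apply IntegrableOn.integrable_indicator _ (hmeas _)
    apply integrableOn_const
    · rw [hμ]; simp
    · exact enorm_ne_top
  have hint : ∀ j, ∫ r, f j r ∂μ = C * w ^ j := by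
    intro j
    simp only [f]
    rw [integral_indicator (hmeas _), setIntegral_const, Measure.real, hμ]
    simp
  have hintn : ∀ j, ∫ r, ‖f j r‖ ∂μ = ‖C‖ * ‖w‖ ^ j := by
    intro j
    simp only [f, norm_indicator_eq_indicator_norm]
    rw [integral_indicator (hmeas _), setIntegral_const, Measure.real, hμ]
    simp
  have key := integral_tsum_of_summable_integral_norm hfi (by
    simp only [hintn]
    exact (summable_geometric_of_lt_one (norm_nonneg _) hwn).mul_left _)
  simp only [hint] at key
  rw [tsum_mul_left, tsum_geometric_of_norm_lt_one hwn] at key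
  rw [one_div, key]
  congr 1
  funext r
  by_cases hr : r = 0
  · subst hr
    rw [(habsF0 0).2 rfl]
    have : ∀ j, f j 0 = 0 := by
      intro j
      simp only [f]
      apply Set.indicator_of_notMem
      simp only [Set.mem_ofPred_eq, (habsF0 0).2 rfl]
      exact (zpow_pos hq0 _).ne
    simp [this, hz0]
  · obtain ⟨m, hm⟩ := hvalF r hr
    rw [hm]
    by_cases hmn : m ≤ n
    · obtain ⟨j, rfl⟩ : ∃ j : ℕ, m = (n : ℤ) - j := ⟨((n : ℤ) - m).toNat, by omega⟩
      rw [tsum_eq_single j]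
      · rw [if_pos (zpow_le_zpow_right₀ hq.le hmn), one_mul, aux_val q hq]
        simp only [f]
        rw [Set.indicator_of_mem (by simpa using hm)]
      · intro i hi
        simp only [f]
        apply Set.indicator_of_notMem
        simp only [Set.mem_ofPred_eq, hm]
        intro h
        have := zpow_right_injective₀ hq0 hq.ne' h
        omega
    · rw [if_neg, zero_mul]
      · symm
        convert tsum_zero with j
        simp only [f]
        apply Set.indicator_of_notMem
        simp only [Set.mem_ofPred_eq, hm]
        intro h
        have := zpow_right_injective₀ hq0 hq.ne' h
        omega
      · rw [zpow_le_zpow_iff_right₀ hq]; exact hmn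

/-- The Fourier transform of `Φ_n`. -/
theorem aux_fhat (F : Type) [Field F]
    (q : ℝ) (hq : 1 < q) (absF : F → ℝ)
    (habsF0 : ∀ x : F, absF x = 0 ↔ x = 0)
    (habsFmul : ∀ x y : F, absF (x * y) = absF x * absF y)
    (habsFadd : ∀ x y : F, absF (x + y) ≤ max (absF x) (absF y))
    (hnn : ∀ x, 0 ≤ absF x) (hneg : ∀ x, absF (-x) = absF x)
    (hvalF : ∀ x : F, x ≠ 0 → ∃ m : ℤ, absF x = q ^ m)
    [MeasurableSpace F]
    (habsFmeas : Measurable absF)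
    (hFmulmeas : Measurable fun p : F × F => p.1 * p.2)
    (hFaddmeas : Measurable fun p : F × F => p.1 + p.2)
    (μa : Measure F) [SigmaFinite μa]
    (hμaadd : ∀ v : F, Measure.map (fun x => x + v) μa = μa)
    (ψF : F → ℂ) (hψmeas : Measurable ψF)
    (hψadd : ∀ x y : F, ψF (x + y) = ψF x * ψF y)
    (hψtriv : ∀ x : F, absF x ≤ 1 → ψF x = 1)
    (hψnontriv : ∃ x : F, absF x ≤ q ∧ ψF x ≠ 1)
    (n : ℕ)
    (hμa1 : μa {x : F | absF x ≤ 1} = 1)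
    (hμan : μa {x : F | absF x ≤ q ^ (-n : ℤ)} = ENNReal.ofReal (q ^ (-n : ℤ)))
    (x y : F) :
    FHat μa ψF (PhiN q absF (n : ℤ)) (x, y)
      = (q : ℂ) ^ (-n : ℤ) * (if absF x ≤ 1 ∧ absF y ≤ q ^ (n : ℤ) then 1 else 0) := by
  have hq0 : (0 : ℝ) < q := by linarith
  have hPhi : Measurable (PhiN q absF (n : ℤ)) := by
    unfold PhiN
    refine Measurable.ite ?_ measurable_const measurable_const
    exact (measurableSet_le (habsFmeas.comp measurable_fst) measurable_const).inter
      (measurableSet_le (habsFmeas.comp measurable_snd) measurable_const)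
  by_cases hxy : absF x ≤ 1 ∧ absF y ≤ q ^ (n : ℤ)
  · rw [if_pos hxy, mul_one]
    obtain ⟨hx, hy⟩ := hxy
    have hset : MeasurableSet ({u : F | absF u ≤ q ^ (-n : ℤ)} ×ˢ {v : F | absF v ≤ 1}) :=
      (measurableSet_le habsFmeas measurable_const).prod (measurableSet_le habsFmeas measurable_const)
    have : ∀ w : F × F, PhiN q absF (n : ℤ) w * ψF (y * w.1 - x * w.2)
        = Set.indicator ({u : F | absF u ≤ q ^ (-n : ℤ)} ×ˢ {v : F | absF v ≤ 1})
          (fun _ => (1 : ℂ)) w := by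
      rintro ⟨u, v⟩
      by_cases h : absF u ≤ q ^ (-n : ℤ) ∧ absF v ≤ 1
      · rw [Set.indicator_of_mem (by simpa using h)]
        simp only [PhiN, if_pos h, one_mul]
        apply hψtriv
        rw [sub_eq_add_neg]
        refine (habsFadd _ _).trans (max_le ?_ ?_)
        · rw [habsFmul]
          calc absF y * absF u ≤ q ^ (n : ℤ) * q ^ (-n : ℤ) :=
                mul_le_mul hy h.1 (hnn _) (zpow_pos hq0 _).le
            _ = 1 := by rw [← zpow_add₀ hq0.ne']; simp
        · rw [hneg, habsFmul]
          exact mul_le_one₀ hx (hnn _) h.2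
      · rw [Set.indicator_of_notMem (by simpa using h)]
        simp only [PhiN, if_neg h, zero_mul]
    simp only [FHat, this]
    rw [integral_indicator hset, setIntegral_const, Measure.real, Measure.prod_prod, hμa1, hμan,
      mul_one, ENNReal.toReal_ofReal (zpow_pos hq0 _).le]
    simp
  · rw [if_neg hxy, mul_zero]
    obtain ⟨t, ht, ht1⟩ := hψnontriv
    have hzero : absF 0 = 0 := (habsF0 0).2 rfl
    obtain ⟨a, b, ha, hb, hab⟩ : ∃ a b : F, absF a ≤ q ^ (-n : ℤ) ∧ absF b ≤ 1 ∧
        y * a - x * b = t := by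
      by_cases hx : absF x ≤ 1
      · have hy : q ^ (n : ℤ) < absF y := by
          by_contra h
          exact hxy ⟨hx, not_lt.1 h⟩
        have hy0 : y ≠ 0 := by
          rintro rfl
          rw [hzero] at hy
          exact absurd hy (zpow_pos hq0 _).not_gt
        obtain ⟨m, hm⟩ := hvalF y hy0
        rw [hm, zpow_lt_zpow_iff_right₀ hq] at hy
        refine ⟨t / y, 0, ?_, by rw [hzero]; norm_num, by field_simp; simp⟩
        have h1 : absF (t / y) * q ^ m = absF t := by
          rw [← hm, ← habsFmul]; congr 1; field_simp
        have h2 : q ≤ q ^ (-n : ℤ) * q ^ m := by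
          rw [← zpow_add₀ hq0.ne']
          nth_rewrite 1 [← zpow_one q]
          exact zpow_le_zpow_right₀ hq.le (by omega)
        exact le_of_mul_le_mul_right (h1.le.trans (ht.trans h2)) (zpow_pos hq0 m)
      · have hx0 : x ≠ 0 := by
          rintro rfl
          rw [hzero] at hx
          norm_num at hx
        obtain ⟨m, hm⟩ := hvalF x hx0
        have hm1 : 0 < m := by
          by_contra h
          apply hx
          rw [hm, ← zpow_zero q]
          exact zpow_le_zpow_right₀ hq.le (by omega)
        refine ⟨0, -(t / x), by rw [hzero]; exact (zpow_pos hq0 _).le, ?_, by field_simp; simp⟩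
        have h1 : absF (t / x) * q ^ m = absF t := by
          rw [← hm, ← habsFmul]; congr 1; field_simp
        have h2 : q ≤ 1 * q ^ m := by
          rw [one_mul]
          nth_rewrite 1 [← zpow_one q]
          exact zpow_le_zpow_right₀ hq.le (by omega)
        rw [hneg]
        exact le_of_mul_le_mul_right (h1.le.trans (ht.trans h2)) (zpow_pos hq0 m)
    have haddm : ∀ v : F, Measurable fun x : F => x + v := fun v =>
      hFaddmeas.comp (measurable_id.prodMk measurable_const)
    have hmulm : ∀ v : F, Measurable fun x : F => v * x := fun v =>
      hFmulmeas.comp (measurable_const.prodMk measurable_id)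
    have hmap : Measure.map (Prod.map (fun x => x + a) (fun x => x + b)) (μa.prod μa)
        = μa.prod μa := by
      have : SigmaFinite (Measure.map (fun x => x + a) μa) := by rw [hμaadd]; infer_instance
      have : SigmaFinite (Measure.map (fun x => x + b) μa) := by rw [hμaadd]; infer_instance
      rw [← Measure.map_prod_map _ _ (haddm a) (haddm b), hμaadd, hμaadd]
    set G : F × F → ℂ := fun w => PhiN q absF (n : ℤ) w * ψF (y * w.1 - x * w.2) with hG
    have hGm : Measurable G := by
      refine hPhi.mul (hψmeas.comp ?_)
      have : (fun w : F × F => y * w.1 - x * w.2) = fun w : F × F => y * w.1 + (-x) * w.2 := by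
        funext w; ring
      rw [this]
      exact hFaddmeas.comp (((hmulm y).comp measurable_fst).prodMk ((hmulm (-x)).comp measurable_snd))
    have hadd_iff : ∀ (r : ℝ) (u c : F), absF c ≤ r → (absF (u + c) ≤ r ↔ absF u ≤ r) := by
      intro r u c hc
      constructor
      · intro h
        have := habsFadd (u + c) (-c)
        rw [add_neg_cancel_right, hneg] at this
        exact this.trans (max_le h hc)
      · intro h
        exact (habsFadd _ _).trans (max_le h hc)
    have hGt : ∀ w : F × F, G (Prod.map (fun x => x + a) (fun x => x + b) w) = ψF t * G w := by
      rintro ⟨u, v⟩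
      have e : y * (u + a) - x * (v + b) = t + (y * u - x * v) := by rw [← hab]; ring
      simp only [hG, Prod.map, PhiN, hadd_iff _ _ _ ha, hadd_iff _ _ _ hb, e, hψadd]
      ring
    have hI : ∫ w, G w ∂(μa.prod μa) = ψF t * ∫ w, G w ∂(μa.prod μa) := by
      nth_rewrite 1 [← hmap]
      rw [integral_map ((haddm a).prodMap (haddm b)).aemeasurable hGm.aestronglyMeasurable]
      simp only [hGt]
      rw [integral_const_mul]
    have : (1 - ψF t) * ∫ w, G w ∂(μa.prod μa) = 0 := by
      rw [sub_mul, one_mul, ← hI, sub_self]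
    rcases mul_eq_zero.1 this with h | h
    · exact absurd (sub_eq_zero.1 h).symm ht1
    · exact h

/-- For `k` a unit of the order `((o_F, p_F^{-n}), (p_F^n, o_F))` and `Re(s) < 1`,
`z(1-s, k, Φ̂_n) = q^{-2n(s-1/2)} L_E(1-s, 1)`. -/
theorem stmt_5
    (F : Type) [Field F] [CharZero F]
    (q : ℝ) (hq : 1 < q)
    (absF : F → ℝ)
    (habsF0 : ∀ x : F, absF x = 0 ↔ x = 0)
    (habsFmul : ∀ x y : F, absF (x * y) = absF x * absF y)
    (habsFadd : ∀ x y : F, absF (x + y) ≤ max (absF x) (absF y))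
    (ϖ : F) (hϖ : absF ϖ = q⁻¹)
    (hvalF : ∀ x : F, x ≠ 0 → ∃ m : ℤ, absF x = q ^ m)
    (habsF2 : absF 2 = 1)
    [MeasurableSpace F]
    (habsFmeas : Measurable absF)
    (hFmulmeas : Measurable fun p : F × F => p.1 * p.2)
    (hFaddmeas : Measurable fun p : F × F => p.1 + p.2)
    (μ : Measure F) [SigmaFinite μ]
    (hμ0 : μ {0} = 0)
    (hμinv : ∀ a : F, a ≠ 0 → Measure.map (fun x => a * x) μ = μ)
    (hμ1 : μ {x : F | absF x = 1} = 1)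
    (μa : Measure F) [SigmaFinite μa]
    (hμaadd : ∀ v : F, Measure.map (fun x => x + v) μa = μa)
    (hμasc : ∀ a : F, a ≠ 0 →
      Measure.map (fun x => a * x) μa = ENNReal.ofReal ((absF a)⁻¹) • μa)
    (hμa1 : μa {x : F | absF x ≤ 1} = 1)
    (ψF : F → ℂ) (hψmeas : Measurable ψF)
    (hψadd : ∀ x y : F, ψF (x + y) = ψF x * ψF y)
    (hψtriv : ∀ x : F, absF x ≤ 1 → ψF x = 1)
    (hψnontriv : ∃ x : F, absF x ≤ q ∧ ψF x ≠ 1)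
    (n : ℕ)
    (k kinv : Matrix (Fin 2) (Fin 2) F)
    (hkinv1 : k * kinv = 1) (hkinv2 : kinv * k = 1)
    (hk00 : absF (k 0 0) ≤ 1) (hk11 : absF (k 1 1) ≤ 1)
    (hk01 : absF (k 0 1) ≤ q ^ (n : ℤ)) (hk10 : absF (k 1 0) ≤ q ^ (-n : ℤ))
    (hki00 : absF (kinv 0 0) ≤ 1) (hki11 : absF (kinv 1 1) ≤ 1)
    (hki01 : absF (kinv 0 1) ≤ q ^ (n : ℤ)) (hki10 : absF (kinv 1 0) ≤ q ^ (-n : ℤ))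
    (s : ℂ) (hs : s.re < 1) :
    zInt μ absF (1 - s) k (FHat μa ψF (PhiN q absF (n : ℤ)))
      = (q : ℂ) ^ (-2 * (n : ℂ) * (s - 1 / 2)) * LEfac q (1 - s) := by
  have hq0 : (0 : ℝ) < q := by linarith
  have hzero : absF 0 = 0 := (habsF0 0).2 rfl
  have hnn : ∀ x, 0 ≤ absF x := by
    intro x
    by_cases h : x = 0
    · rw [h, hzero]
    · obtain ⟨m, hm⟩ := hvalF x h
      rw [hm]; exact (zpow_pos hq0 m).le
  have hone : absF 1 = 1 := by
    have h := habsFmul 1 1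
    rw [mul_one] at h
    have h0 : absF 1 ≠ 0 := fun h => one_ne_zero ((habsF0 1).1 h)
    exact (mul_left_cancel₀ h0 (by rw [mul_one]; exact h)).symm
  have hneg1 : absF (-1) = 1 := by
    have h := habsFmul (-1) (-1)
    rw [neg_mul_neg, one_mul, hone] at h
    nlinarith [hnn (-1)]
  have hneg : ∀ x, absF (-x) = absF x := by
    intro x
    rw [← neg_one_mul, habsFmul, hneg1, one_mul]
  have hmulm : ∀ v : F, Measurable fun x : F => v * x := fun v =>
    hFmulmeas.comp (measurable_const.prodMk measurable_id)
  -- elements of every absolute value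
  have hnat : ∀ j : ℕ, absF (ϖ ^ j) = q⁻¹ ^ j := by
    intro j
    induction j with
    | zero => simpa using hone
    | succ j ih => rw [pow_succ, habsFmul, ih, hϖ, pow_succ]
  have hex : ∀ m : ℤ, ∃ a : F, a ≠ 0 ∧ absF a = q ^ m := by
    intro m
    have hϖ0 : ϖ ≠ 0 := by
      rintro rfl
      rw [hzero] at hϖ
      exact absurd hϖ (inv_pos.2 hq0).ne
    rcases Int.eq_nat_or_neg m with ⟨j, rfl | rfl⟩
    · refine ⟨(ϖ ^ j)⁻¹, inv_ne_zero (pow_ne_zero _ hϖ0), ?_⟩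
      have h1 : absF ((ϖ ^ j)⁻¹) * absF (ϖ ^ j) = 1 := by
        rw [← habsFmul, inv_mul_cancel₀ (pow_ne_zero _ hϖ0), hone]
      rw [hnat] at h1
      rw [eq_inv_of_mul_eq_one_left h1]
      simp
    · refine ⟨ϖ ^ j, pow_ne_zero _ hϖ0, ?_⟩
      rw [hnat]; simp
  have hμm : ∀ m : ℤ, μ {x : F | absF x = q ^ m} = 1 := by
    intro m
    obtain ⟨a, ha0, ha⟩ := hex m
    have hms : MeasurableSet {x : F | absF x = q ^ m} := habsFmeas (measurableSet_singleton _)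
    rw [← hμinv a ha0, Measure.map_apply (hmulm a) hms, ← hμ1]
    congr 1
    ext x
    simp only [Set.mem_preimage, Set.mem_ofPred_eq, habsFmul, ha]
    exact mul_eq_left₀ (zpow_pos hq0 m).ne'
  have hμan : μa {x : F | absF x ≤ q ^ (-n : ℤ)} = ENNReal.ofReal (q ^ (-n : ℤ)) := by
    obtain ⟨a, ha0, ha⟩ := hex (-n : ℤ)
    have h := congrArg (fun ν : Measure F => ν {x : F | absF x ≤ q ^ (-n : ℤ)}) (hμasc a ha0)
    simp only [Measure.smul_apply, smul_eq_mul] at h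
    rw [Measure.map_apply (hmulm a) (measurableSet_le habsFmeas measurable_const)] at h
    have e : (fun x => a * x) ⁻¹' {x : F | absF x ≤ q ^ (-n : ℤ)} = {x : F | absF x ≤ 1} := by
      ext x
      simp only [Set.mem_preimage, Set.mem_ofPred_eq, habsFmul, ha]
      exact mul_le_iff_le_one_right (zpow_pos hq0 _)
    rw [e, hμa1, ha, ENNReal.ofReal_inv_of_pos (zpow_pos hq0 _)] at h
    have h2 := ENNReal.eq_inv_of_mul_eq_one_left (h.symm.trans rfl |> fun h' => (mul_comm _ _).trans h')
    rw [h2, inv_inv]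
  have hcond : ∀ r : F, (absF (r * k 1 0) ≤ 1 ∧ absF (r * k 1 1) ≤ q ^ (n : ℤ)) ↔
      absF r ≤ q ^ (n : ℤ) := by
    intro r
    have hqn : (0 : ℝ) < q ^ (n : ℤ) := zpow_pos hq0 _
    have hinv : q ^ (n : ℤ) * q ^ (-n : ℤ) = 1 := by rw [← zpow_add₀ hq0.ne']; simp
    rw [habsFmul, habsFmul]
    constructor
    · rintro ⟨h1, h2⟩
      have e : k 1 0 * kinv 0 1 + k 1 1 * kinv 1 1 = 1 := by
        have := congrFun (congrFun hkinv1 1) 1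
        simpa [Matrix.mul_apply, Fin.sum_univ_two] using this
      have e2 : r = (r * k 1 0) * kinv 0 1 + (r * k 1 1) * kinv 1 1 := by
        linear_combination (-r) * e
      rw [e2]
      refine (habsFadd _ _).trans (max_le ?_ ?_)
      · rw [habsFmul, habsFmul]
        calc _ ≤ 1 * q ^ (n : ℤ) := mul_le_mul h1 hki01 (hnn _) zero_le_one
          _ = _ := one_mul _
      · rw [habsFmul, habsFmul]
        calc _ ≤ q ^ (n : ℤ) * 1 := mul_le_mul h2 hki11 (hnn _) hqn.le
          _ = _ := mul_one _
    · intro h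
      constructor
      · calc _ ≤ q ^ (n : ℤ) * q ^ (-n : ℤ) := mul_le_mul h hk10 (hnn _) hqn.le
          _ = 1 := hinv
      · calc _ ≤ q ^ (n : ℤ) * 1 := mul_le_mul h hk11 (hnn _) hqn.le
          _ = _ := mul_one _
  have hz : 0 < (1 - s).re := by simp; linarith
  have hF := aux_fhat F q hq absF habsF0 habsFmul habsFadd hnn hneg hvalF habsFmeas hFmulmeas
    hFaddmeas μa hμaadd ψF hψmeas hψadd hψtriv hψnontriv n hμa1 hμan
  unfold zInt
  simp only [hF, hcond, mul_assoc]
  rw [integral_const_mul, aux_int F q hq absF habsF0 hvalF habsFmeas μ hμm n (1 - s) hz, LEfac,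
    ← mul_assoc]
  congr 1
  have hqc : (q : ℂ) ≠ 0 := by exact_mod_cast hq0.ne'
  rw [← Complex.cpow_intCast, ← Complex.cpow_add _ _ hqc]
  congr 1
  push_cast
  ring
end
end

section
/- Let n be a non-negative integer. Then for every k ∈ K_{n,H} and every s ∈ ℂ with Re(s) < 1, f(1−s, k, Φ̂_n) = q^{−2n(s−1/2)}·L_E(1−s, 1). -/
set_option autoImplicit false

open MeasureTheory Matrix

noncomputable section

/-- `t(a) = diag(a, conj(a)⁻¹)`. -/
def tdiag {E : Type} [Field E] (σ : E → E) (a : E) : Matrix (Fin 2) (Fin 2) E :=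
  !![a, 0; 0, (σ a)⁻¹]

/-- `d(c) = diag(c, 1)`. -/
def ddiag {E : Type} [Field E] (c : E) : Matrix (Fin 2) (Fin 2) E := !![c, 0; 0, 1]

/-- `H = U(1,1)(E/F) = {h : ᵗh̄ J₂ h = J₂}` with `J₂` the 2×2 antidiagonal matrix. -/
def HsetM {E : Type} [Field E] (σ : E → E) : Set (Matrix (Fin 2) (Fin 2) E) :=
  {m | (m.map σ)ᵀ * !![(0 : E), 1; 1, 0] * m = !![(0 : E), 1; 1, 0]}

/-- `U_H`, the upper triangular unipotent subgroup of `H`. -/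
def UHsetM {E : Type} [Field E] (σ : E → E) : Set (Matrix (Fin 2) (Fin 2) E) :=
  {m | ∃ y : E, y + σ y = 0 ∧ m = !![1, y; 0, 1]}

/-- `K_{n,H} = {(a,b;c,d) ∈ H : a, d ∈ o_E, b ∈ p_E^{-n}, c ∈ p_E^n}`. -/
def KHset {E : Type} [Field E] (q : ℝ) (σ : E → E) (absE : E → ℝ) (n : ℤ) :
    Set (Matrix (Fin 2) (Fin 2) E) :=
  {m | m ∈ HsetM σ ∧ absE (m 0 0) ≤ 1 ∧ absE (m 1 1) ≤ 1 ∧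
    absE (m 0 1) ≤ (q ^ 2) ^ n ∧ absE (m 1 0) ≤ (q ^ 2) ^ (-n)}

/-- `h = t(b) d(√ε) h₁ d(√ε)⁻¹` is a decomposition of `h` with `b ∈ E^×` and
`h₁ ∈ SL₂(F)`. -/
def IsDecomp {F E : Type} [Field F] [Field E] [Algebra F E] (σ : E → E) (sqrtε : E)
    (b : E) (h₁ : Matrix (Fin 2) (Fin 2) F) (h : Matrix (Fin 2) (Fin 2) E) : Prop :=
  b ≠ 0 ∧ h₁.det = 1 ∧
    h = tdiag σ b * ddiag sqrtε * h₁.map (algebraMap F E) * ddiag sqrtε⁻¹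

lemma aux_decomp {F E : Type} [Field F] [CharZero F] [Field E] [Algebra F E]
    (σ : E → E)
    (hσadd : ∀ x y : E, σ (x + y) = σ x + σ y)
    (hσmul : ∀ x y : E, σ (x * y) = σ x * σ y)
    (hσinvol : ∀ x : E, σ (σ x) = x)
    (hσfix : ∀ x : F, σ (algebraMap F E x) = algebraMap F E x)
    (sqrtε : E) (hε0 : sqrtε ≠ 0)
    (hσsqrtε : σ sqrtε = -sqrtε)
    (hspan : ∀ x : E, ∃ a b : F, x = algebraMap F E a + algebraMap F E b * sqrtε)
    (k : Matrix (Fin 2) (Fin 2) E) (hk : k ∈ HsetM σ) :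
    σ (k 0 0) * k 1 1 + σ (k 1 0) * k 0 1 = 1 ∧
    ∃ (β : E) (h₁ : Matrix (Fin 2) (Fin 2) F), IsDecomp σ sqrtε β h₁ k ∧
      algebraMap F E (h₁ 1 0) = σ β * k 1 0 * sqrtε ∧
      algebraMap F E (h₁ 1 1) = σ β * k 1 1 := by
  have hσ1 : σ 1 = 1 := by simpa using hσfix 1
  have hσ0 : σ 0 = 0 := by simpa using hσfix 0
  have hσneg : ∀ x, σ (-x) = -σ x := by
    intro x
    have := hσadd x (-x)
    rw [add_neg_cancel, hσ0] at this
    linear_combination -this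
  have hσne : ∀ x, x ≠ 0 → σ x ≠ 0 := by
    intro x hx h
    apply hx
    rw [← hσinvol x, h, hσ0]
  have hσinv : ∀ x, σ x⁻¹ = (σ x)⁻¹ := by
    intro x
    by_cases hx : x = 0
    · simp [hx, hσ0]
    · apply eq_inv_of_mul_eq_one_left
      rw [← hσmul, inv_mul_cancel₀ hx, hσ1]
  have hE2 : (2 : E) ≠ 0 := by
    have : algebraMap F E 2 ≠ 0 := (map_ne_zero _).2 two_ne_zero
    rwa [map_ofNat] at this
  have hF : ∀ x, σ x = x → ∃ a : F, algebraMap F E a = x := by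
    intro x hx
    obtain ⟨a, b, rfl⟩ := hspan x
    rw [hσadd, hσmul, hσfix, hσfix, hσsqrtε] at hx
    have h2 : 2 * (algebraMap F E b * sqrtε) = 0 := by linear_combination -hx
    have h3 := (mul_eq_zero.mp h2).resolve_left hE2
    exact ⟨a, by rw [h3, add_zero]⟩
  have hk' : (k.map σ)ᵀ * !![(0 : E), 1; 1, 0] * k = !![(0 : E), 1; 1, 0] := hk
  have hl : (!![(0 : E), 1; 1, 0] * (k.map σ)ᵀ * !![(0 : E), 1; 1, 0]) * k = 1 := by
    rw [Matrix.mul_assoc, Matrix.mul_assoc, ← Matrix.mul_assoc (k.map σ)ᵀ, hk']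
    ext i j; fin_cases i <;> fin_cases j <;> simp
  have hr := mul_eq_one_comm.mp hl
  have e01 := congrFun (congrFun hk' 0) 1
  have r00 := congrFun (congrFun hr 0) 0
  have r01 := congrFun (congrFun hr 0) 1
  have r11 := congrFun (congrFun hr 1) 1
  have r10 := congrFun (congrFun hr 1) 0
  simp only [Matrix.mul_apply, Fin.sum_univ_two, Matrix.transpose_apply, Matrix.map_apply] at e01 r00 r01 r10 r11
  simp at e01 r00 r01 r10 r11
  have l00 := congrFun (congrFun hk' 0) 0
  have l11 := congrFun (congrFun hk' 1) 1
  simp only [Matrix.mul_apply, Fin.sum_univ_two, Matrix.transpose_apply, Matrix.map_apply] at l00 l11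
  simp at l00 l11
  generalize ha : k 0 0 = a at *
  generalize hb : k 0 1 = b at *
  generalize hc : k 1 0 = c at *
  generalize hd : k 1 1 = d at *
  refine ⟨by linear_combination e01, ?_⟩
  by_cases hd0 : d = 0
  · subst hd0
    have hc0 : c ≠ 0 := by
      rintro rfl
      simp [hσ0] at r00
    have hsc0 := hσne c hc0
    have hbc : b * σ c = 1 := by simp [hσ0] at r00; linear_combination r00
    obtain ⟨a1, ha1⟩ := hF (-(a * sqrtε * σ c)) (by
      rw [hσneg, hσmul, hσmul, hσsqrtε, hσinvol]; linear_combination sqrtε * l00)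
    refine ⟨-(sqrtε * σ c)⁻¹, !![a1, -1; 1, 0], ⟨?_, ?_, ?_⟩, ?_, ?_⟩
    · simp [hε0, hsc0]
    · simp
    · rw [Matrix.eta_fin_two k, ha, hb, hc, hd]
      have hb' : b = (σ c)⁻¹ := eq_inv_of_mul_eq_one_left hbc
      ext i j
      fin_cases i <;> fin_cases j <;>
        simp only [tdiag, ddiag, Matrix.mul_apply, Fin.sum_univ_two, Matrix.map_apply] <;>
        simp [ha1, hσneg, hσinv, hσmul, hσinvol, hσsqrtε, hb'] <;> try field_simp
    · simp [hσneg, hσinv, hσmul, hσinvol, hσsqrtε]; field_simp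
    · simp
  · have hsd0 := hσne d hd0
    obtain ⟨a1, ha1⟩ := hF (a * σ d) (by
      rw [hσmul, hσinvol]; linear_combination e01 - r00)
    obtain ⟨b1, hb1⟩ := hF (b * σ d * sqrtε⁻¹) (by
      rw [hσmul, hσmul, hσinvol, hσinv, hσsqrtε, inv_neg]; linear_combination -sqrtε⁻¹ * l11)
    obtain ⟨c1, hc1⟩ := hF (d⁻¹ * c * sqrtε) (by
      rw [hσmul, hσmul, hσsqrtε, hσinv]
      field_simp
      linear_combination - r10)
    refine ⟨(σ d)⁻¹, !![a1, b1; c1, 1], ⟨?_, ?_, ?_⟩, ?_, ?_⟩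
    · simp [hsd0]
    · apply (algebraMap F E).injective
      simp [Matrix.det_fin_two, ha1, hb1, hc1]
      field_simp
      linear_combination d * r00 - b * r10
    · rw [Matrix.eta_fin_two k, ha, hb, hc, hd]
      ext i j
      fin_cases i <;> fin_cases j <;>
        simp only [tdiag, ddiag, Matrix.mul_apply, Fin.sum_univ_two, Matrix.map_apply] <;>
        simp [ha1, hb1, hc1, hσinv, hσinvol] <;> try field_simp
    · simp [hσinv, hσinvol, hc1]
    · simp [hσinv, hσinvol, hd0]

lemma aux_char {F : Type} [Field F] [MeasurableSpace F]
    (absF : F → ℝ) (habsFadd : ∀ x y : F, absF (x + y) ≤ max (absF x) (absF y))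
    (habsneg : ∀ x, absF (-x) = absF x)
    (habsFmeas : Measurable absF)
    (hFmulmeas : Measurable fun p : F × F => p.1 * p.2)
    (hFaddmeas : Measurable fun p : F × F => p.1 + p.2)
    (μa : Measure F)
    (hμaadd : ∀ v : F, Measure.map (fun x => x + v) μa = μa)
    (ψF : F → ℂ) (hψmeas : Measurable ψF)
    (hψadd : ∀ x y : F, ψF (x + y) = ψF x * ψF y) (R : ℝ) (y : F) 
    (h : (∀ u, absF u ≤ R → ψF (y * u) = 1) ∨ ∃ u, absF u ≤ R ∧ ψF (y * u) ≠ 1) :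
    ∫ u, (if absF u ≤ R then 1 else 0) * ψF (y * u) ∂μa =
      open Classical in if (∀ u, absF u ≤ R → ψF (y * u) = 1) then (μa.real {x | absF x ≤ R} : ℂ) else 0 := by
  classical
  have hmul : ∀ a : F, Measurable fun x => a * x := fun a =>
    hFmulmeas.comp (measurable_const.prodMk measurable_id)
  have hadd : ∀ a : F, Measurable fun x => x + a := fun a =>
    hFaddmeas.comp (measurable_id.prodMk measurable_const)
  have hset : MeasurableSet {x | absF x ≤ R} := habsFmeas measurableSet_Iic
  split_ifs with h1
  · rw [← integral_indicator_one hset, ← integral_complex_ofReal]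
    congr 1
    ext u
    by_cases hu : absF u ≤ R
    · simp [hu, h1 u hu]
    · simp [hu]
  · obtain ⟨u0, hu0, hne⟩ := h.resolve_left h1
    set f : F → ℂ := fun u => (if absF u ≤ R then 1 else 0) * ψF (y * u) with hf
    have hfm : Measurable f :=
      (Measurable.ite hset measurable_const measurable_const).mul (hψmeas.comp (hmul y))
    have e1 : ∫ u, f (u + u0) ∂μa = ∫ u, f u ∂μa := by
      conv_rhs => rw [← hμaadd u0]
      rw [integral_map (hadd u0).aemeasurable hfm.aestronglyMeasurable]
    have e2 : ∀ u, f (u + u0) = f u * ψF (y * u0) := by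
      intro u
      have : absF (u + u0) ≤ R ↔ absF u ≤ R := by
        constructor
        · intro h
          have := habsFadd (u + u0) (-u0)
          rw [add_neg_cancel_right, habsneg] at this
          exact this.trans (max_le h hu0)
        · intro h
          exact (habsFadd _ _).trans (max_le h hu0)
      simp only [hf, this, mul_add, hψadd, mul_assoc]
    simp_rw [e2] at e1
    rw [integral_mul_const] at e1
    have : (∫ u, f u ∂μa) * (ψF (y * u0) - 1) = 0 := by linear_combination e1
    exact (mul_eq_zero.mp this).resolve_right (sub_ne_zero.mpr hne)

lemma aux_zeta {F : Type} [Field F] [MeasurableSpace F] (q : ℝ) (hq : 1 < q)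
    (absF : F → ℝ)
    (habsF0 : ∀ x : F, absF x = 0 ↔ x = 0)
    (habsFmul : ∀ x y : F, absF (x * y) = absF x * absF y)
    (ϖ : F) (hϖ : absF ϖ = q⁻¹)
    (hvalF : ∀ x : F, x ≠ 0 → ∃ m : ℤ, absF x = q ^ m)
    (habsFmeas : Measurable absF)
    (hFmulmeas : Measurable fun p : F × F => p.1 * p.2)
    (μ : Measure F)
    (hμinv : ∀ a : F, a ≠ 0 → Measure.map (fun x => a * x) μ = μ)
    (hμ1 : μ {x : F | absF x = 1} = 1) (j : ℤ) (s : ℂ) (hs : 0 < s.re) :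
    ∫ r, (if absF r ≤ q ^ j then 1 else 0) * Complex.ofReal (absF r ^ 2) ^ s ∂μ =
      Complex.ofReal ((q ^ j) ^ 2) ^ s * LEfac q s := by
  have hq0 : 0 < q := by linarith
  have hϖ0 : ϖ ≠ 0 := by
    intro h
    rw [(habsF0 ϖ).2 h] at hϖ
    exact (inv_pos.2 hq0).ne hϖ
  have habs1 : absF 1 = 1 := by
    have h := habsFmul 1 1
    have h0 : absF 1 ≠ 0 := fun h => one_ne_zero ((habsF0 1).1 h)
    rw [mul_one] at h
    exact (mul_eq_left₀ h0).mp h.symm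
  have hmul : ∀ a : F, Measurable fun x => a * x := fun a =>
    hFmulmeas.comp (measurable_const.prodMk measurable_id)
  have hpow : ∀ i : ℕ, absF (ϖ ^ i) = q⁻¹ ^ i := by
    intro i
    induction i with
    | zero => simpa using habs1
    | succ i ih => rw [pow_succ, habsFmul, ih, hϖ, pow_succ]
  have hinv : ∀ x, absF x⁻¹ = (absF x)⁻¹ := by
    intro x
    by_cases hx : x = 0
    · simp [hx, (habsF0 0).2 rfl]
    · apply eq_inv_of_mul_eq_one_left
      rw [← habsFmul, inv_mul_cancel₀ hx, habs1]
  have hzp : ∀ i : ℤ, ∃ a : F, a ≠ 0 ∧ absF a = q ^ i := by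
    intro i
    obtain ⟨m, rfl | rfl⟩ := i.eq_nat_or_neg
    · exact ⟨(ϖ ^ m)⁻¹, inv_ne_zero (pow_ne_zero _ hϖ0), by rw [hinv, hpow]; simp⟩
    · exact ⟨ϖ ^ m, pow_ne_zero _ hϖ0, by rw [hpow]; simp⟩
  have hms : ∀ c : ℝ, MeasurableSet {x : F | absF x = c} := fun c =>
    habsFmeas (measurableSet_singleton c)
  have hshell : ∀ i : ℤ, μ {x : F | absF x = q ^ i} = 1 := by
    intro i
    obtain ⟨a, ha, hai⟩ := hzp i
    rw [← hμinv a ha, Measure.map_apply (hmul a) (hms _), ← hμ1]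
    congr 1
    ext x
    have : q ^ i ≠ 0 := by positivity
    simp [habsFmul, hai, this]
  set G : ℕ → F → ℂ := fun i => Set.indicator {x : F | absF x = q ^ (j - i)}
    (fun _ => Complex.ofReal ((q ^ (j - i)) ^ 2) ^ s) with hG
  set A : ℂ := Complex.ofReal ((q ^ j) ^ 2) ^ s with hA
  set ρ : ℂ := (q : ℂ) ^ (-2 * s) with hρ
  have hterm : ∀ i : ℕ, Complex.ofReal ((q ^ (j - i)) ^ 2) ^ s = A * ρ ^ i := by
    intro i
    have e : (q ^ (j - (i:ℤ))) ^ 2 = (q ^ j) ^ 2 * (q⁻¹ ^ (2 * i)) := by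
      rw [zpow_sub₀ hq0.ne', div_pow, inv_pow, pow_mul', zpow_natCast]; rfl
    rw [e, Complex.ofReal_mul, Complex.mul_cpow_ofReal_nonneg (by positivity) (by positivity)]
    congr 1
    have hqc : (q : ℂ) ≠ 0 := by exact_mod_cast hq0.ne'
    have hl : Complex.log ((q⁻¹ ^ (2 * i) : ℝ) : ℂ) = -(2 * i) * Complex.log q := by
      rw [← Complex.ofReal_log (by positivity), ← Complex.ofReal_log hq0.le, Real.log_pow, Real.log_inv]
      push_cast; ring
    have hx : ((q⁻¹ ^ (2 * i) : ℝ) : ℂ) ≠ 0 := by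
      have : q⁻¹ ^ (2 * i) ≠ 0 := by positivity
      exact_mod_cast this
    rw [Complex.cpow_def_of_ne_zero hx, hl, hρ, Complex.cpow_def_of_ne_zero hqc, ← Complex.exp_nat_mul]
    congr 1; ring
  have hρn : ‖ρ‖ < 1 := by
    rw [hρ, Complex.norm_cpow_eq_rpow_re_of_pos hq0]
    apply Real.rpow_lt_one_of_one_lt_of_neg hq
    simp [hs]
  have hGint : ∀ i, Integrable (G i) μ := by
    intro i
    rw [hG]
    apply (integrable_indicator_iff (hms _)).2
    apply integrableOn_const
    · rw [hshell]; simp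
    · simp
  have hGi : ∀ i, ∫ r, G i r ∂μ = A * ρ ^ i := by
    intro i
    rw [hG]
    simp only
    rw [integral_indicator_const _ (hms _), Measure.real, hshell, hterm]
    simp
  have hGn : ∀ i, ∫ r, ‖G i r‖ ∂μ = ‖A‖ * ‖ρ‖ ^ i := by
    intro i
    rw [hG]
    simp only [norm_indicator_eq_indicator_norm]
    rw [integral_indicator_const _ (hms _), Measure.real, hshell, hterm]
    simp
  have key := hasSum_integral_of_summable_integral_norm hGint (by
    simp_rw [hGn]
    exact (summable_geometric_of_lt_one (norm_nonneg _) hρn).mul_left _)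
  simp_rw [hGi] at key
  have key2 := (hasSum_geometric_of_norm_lt_one hρn).mul_left A
  have := key.unique key2
  rw [LEfac, one_div, ← hρ, ← this]
  congr 1
  ext r
  by_cases hr : ∃ i : ℕ, absF r = q ^ (j - (i : ℤ))
  · obtain ⟨i, hi⟩ := hr
    rw [tsum_eq_single i]
    · have h1 : absF r ≤ q ^ j := by
        rw [hi]; exact zpow_le_zpow_right₀ hq.le (by omega)
      simp only [h1, hG, Set.indicator, Set.mem_ofPred_eq]
      rw [if_pos hi, if_pos trivial, one_mul, hi]
    · intro i' hi'
      simp only [hG, Set.indicator, Set.mem_ofPred_eq]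
      rw [if_neg]
      rw [hi]
      intro h
      have := zpow_right_injective₀ hq0 hq.ne' h
      omega
  · have : ∀ i, G i r = 0 := by
      intro i
      simp only [hG, Set.indicator, Set.mem_ofPred_eq]
      rw [if_neg (fun h => hr ⟨i, h⟩)]
    simp only [this, tsum_zero]
    by_cases hr0 : r = 0
    · have hs0 : s ≠ 0 := by rintro rfl; simp at hs
      rw [hr0, (habsF0 0).2 rfl]
      simp [hs0]
    · obtain ⟨m, hm⟩ := hvalF r hr0
      rw [if_neg, zero_mul]
      intro h
      apply hr
      rw [hm] at h
      have := (zpow_le_zpow_iff_right₀ hq).1 h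
      exact ⟨(j - m).toNat, by rw [hm]; congr 1; omega⟩

/-- For every `k ∈ K_{n,H}` and `Re(s) < 1`,
`f(1-s, k, Φ̂_n) = q^{-2n(s-1/2)} L_E(1-s, 1)`. -/
theorem stmt_6
    (F : Type) [Field F] [CharZero F]
    (q : ℝ) (hq : 1 < q)
    (absF : F → ℝ)
    (habsF0 : ∀ x : F, absF x = 0 ↔ x = 0)
    (habsFmul : ∀ x y : F, absF (x * y) = absF x * absF y)
    (habsFadd : ∀ x y : F, absF (x + y) ≤ max (absF x) (absF y))
    (ϖ : F) (hϖ : absF ϖ = q⁻¹)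
    (hvalF : ∀ x : F, x ≠ 0 → ∃ m : ℤ, absF x = q ^ m)
    (habsF2 : absF 2 = 1)
    [MeasurableSpace F]
    (habsFmeas : Measurable absF)
    (hFmulmeas : Measurable fun p : F × F => p.1 * p.2)
    (hFaddmeas : Measurable fun p : F × F => p.1 + p.2)
    (μ : Measure F) [SigmaFinite μ]
    (hμ0 : μ {0} = 0)
    (hμinv : ∀ a : F, a ≠ 0 → Measure.map (fun x => a * x) μ = μ)
    (hμ1 : μ {x : F | absF x = 1} = 1)
    (μa : Measure F) [SigmaFinite μa]
    (hμaadd : ∀ v : F, Measure.map (fun x => x + v) μa = μa)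
    (hμasc : ∀ a : F, a ≠ 0 →
      Measure.map (fun x => a * x) μa = ENNReal.ofReal ((absF a)⁻¹) • μa)
    (hμa1 : μa {x : F | absF x ≤ 1} = 1)
    (ψF : F → ℂ) (hψmeas : Measurable ψF)
    (hψadd : ∀ x y : F, ψF (x + y) = ψF x * ψF y)
    (hψtriv : ∀ x : F, absF x ≤ 1 → ψF x = 1)
    (hψnontriv : ∃ x : F, absF x ≤ q ∧ ψF x ≠ 1)
    (E : Type) [Field E] [Algebra F E]
    (σ : E → E)
    (hσadd : ∀ x y : E, σ (x + y) = σ x + σ y)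
    (hσmul : ∀ x y : E, σ (x * y) = σ x * σ y)
    (hσinvol : ∀ x : E, σ (σ x) = x)
    (hσfix : ∀ x : F, σ (algebraMap F E x) = algebraMap F E x)
    (ε : F) (sqrtε : E)
    (hεabs : absF ε = 1)
    (hεnonsq : ∀ a : F, a * a ≠ ε)
    (hsqrtε : sqrtε * sqrtε = algebraMap F E ε)
    (hσsqrtε : σ sqrtε = -sqrtε)
    (hspan : ∀ x : E, ∃ a b : F, x = algebraMap F E a + algebraMap F E b * sqrtε)
    (absE : E → ℝ)
    (habsE0 : ∀ x : E, absE x = 0 ↔ x = 0)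
    (habsEmul : ∀ x y : E, absE (x * y) = absE x * absE y)
    (habsEadd : ∀ x y : E, absE (x + y) ≤ max (absE x) (absE y))
    (habsEF : ∀ x : F, absE (algebraMap F E x) = absF x ^ 2)
    (habsEconj : ∀ x : E, absE (σ x) = absE x)
    (habsEspan : ∀ a b : F,
      absE (algebraMap F E a + algebraMap F E b * sqrtε) = max (absF a ^ 2) (absF b ^ 2))
    (hvalE : ∀ x : E, x ≠ 0 → ∃ m : ℤ, absE x = (q ^ 2) ^ m)
    (fE : ℂ → Matrix (Fin 2) (Fin 2) E → (F × F → ℂ) → ℂ)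
    (hfE : ∀ (s : ℂ) (h : Matrix (Fin 2) (Fin 2) E) (Φ : F × F → ℂ)
      (b : E) (h₁ : Matrix (Fin 2) (Fin 2) F), IsDecomp σ sqrtε b h₁ h →
      fE s h Φ = Complex.ofReal (absE b) ^ s * zInt μ absF s h₁ Φ)
    (n : ℕ)
    (k : Matrix (Fin 2) (Fin 2) E) (hk : k ∈ KHset q σ absE (n : ℤ))
    (s : ℂ) (hs : s.re < 1) :
    fE (1 - s) k (FHat μa ψF (PhiN q absF (n : ℤ)))
      = (q : ℂ) ^ (-2 * (n : ℂ) * (s - 1 / 2)) * LEfac q (1 - s) := by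
  have hq0 : 0 < q := by linarith
  have hϖ0 : ϖ ≠ 0 := by
    intro h
    rw [(habsF0 ϖ).2 h] at hϖ
    exact (inv_pos.2 hq0).ne hϖ
  have hF0 : absF 0 = 0 := (habsF0 0).2 rfl
  have hFpos : ∀ x, x ≠ 0 → 0 < absF x := by
    intro x hx
    obtain ⟨m, hm⟩ := hvalF x hx
    rw [hm]; positivity
  have hFnn : ∀ x, 0 ≤ absF x := by
    intro x
    by_cases hx : x = 0
    · rw [hx, hF0]
    · exact (hFpos x hx).le
  have hEpos : ∀ x, x ≠ 0 → 0 < absE x := by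
    intro x hx
    obtain ⟨m, hm⟩ := hvalE x hx
    rw [hm]; positivity
  have hEnn : ∀ x, 0 ≤ absE x := by
    intro x
    by_cases hx : x = 0
    · rw [hx, (habsE0 0).2 rfl]
    · exact (hEpos x hx).le
  have habs1 : absF 1 = 1 := by
    have h := habsFmul 1 1
    have h0 : absF 1 ≠ 0 := fun h => one_ne_zero ((habsF0 1).1 h)
    rw [mul_one] at h
    exact (mul_eq_left₀ h0).mp h.symm
  have habsneg1 : absF (-1) = 1 := by
    have h := habsFmul (-1) (-1)
    rw [neg_mul_neg, one_mul, habs1] at h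
    nlinarith [hFnn (-1)]
  have habsneg : ∀ x, absF (-x) = absF x := by
    intro x
    rw [← neg_one_mul, habsFmul, habsneg1, one_mul]
  have hinv : ∀ x, absF x⁻¹ = (absF x)⁻¹ := by
    intro x
    by_cases hx : x = 0
    · simp [hx, hF0]
    · apply eq_inv_of_mul_eq_one_left
      rw [← habsFmul, inv_mul_cancel₀ hx, habs1]
  have hpow : ∀ i : ℕ, absF (ϖ ^ i) = q⁻¹ ^ i := by
    intro i
    induction i with
    | zero => simpa using habs1
    | succ i ih => rw [pow_succ, habsFmul, ih, hϖ, pow_succ]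
  have hmulm : ∀ a : F, Measurable fun x => a * x := fun a =>
    hFmulmeas.comp (measurable_const.prodMk measurable_id)
  -- volume of `p^n`
  have hvol : ∀ i : ℕ, μa.real {x | absF x ≤ q ^ (-(i : ℤ))} = q ^ (-(i : ℤ)) := by
    intro i
    have hms : MeasurableSet {x | absF x ≤ q ^ (-(i : ℤ))} := habsFmeas measurableSet_Iic
    have h := congrArg (fun m => m {x | absF x ≤ q ^ (-(i : ℤ))})
      (hμasc (ϖ ^ i) (pow_ne_zero _ hϖ0))
    simp only [Measure.smul_apply, smul_eq_mul] at h
    rw [Measure.map_apply (hmulm _) hms] at h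
    have hs : (fun x => ϖ ^ i * x) ⁻¹' {x | absF x ≤ q ^ (-(i : ℤ))} = {x | absF x ≤ 1} := by
      ext x
      have hp : 0 < (q ^ i)⁻¹ := by positivity
      simp only [Set.mem_preimage, Set.mem_ofPred_eq, habsFmul, hpow, _root_.zpow_neg, zpow_natCast,
        inv_pow]
      exact mul_le_iff_le_one_right hp
    rw [hs, hμa1, hpow] at h
    have h2 := congrArg ENNReal.toReal h
    rw [ENNReal.toReal_mul, ENNReal.toReal_ofReal (by positivity)] at h2
    simp only [ENNReal.toReal_one, inv_pow, inv_inv] at h2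
    rw [Measure.real, _root_.zpow_neg, zpow_natCast]
    rw [_root_.zpow_neg, zpow_natCast] at h2
    exact eq_inv_of_mul_eq_one_right h2.symm
  -- triviality of the character on a ball
  have htriv : ∀ (i : ℕ) (y : F),
      (∀ u, absF u ≤ q ^ (-(i : ℤ)) → ψF (y * u) = 1) ↔ absF y ≤ q ^ (i : ℤ) := by
    intro i y
    constructor
    · intro h
      by_contra! hlt
      have hy0 : y ≠ 0 := by
        rintro rfl
        rw [hF0] at hlt
        have : 0 < q ^ (i : ℤ) := by positivity
        linarith
      obtain ⟨m, hm⟩ := hvalF y hy0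
      rw [hm] at hlt
      have hlt' := (zpow_lt_zpow_iff_right₀ hq).1 hlt
      obtain ⟨x0, hx0, hne⟩ := hψnontriv
      apply hne
      have := h (y⁻¹ * x0) (by
        rw [habsFmul, hinv, hm, ← _root_.zpow_neg]
        calc q ^ (-m) * absF x0 ≤ q ^ (-m) * q := by gcongr
          _ = q ^ (-m + 1) := by rw [zpow_add_one₀ hq0.ne']
          _ ≤ _ := zpow_le_zpow_right₀ hq.le (by omega))
      rwa [mul_inv_cancel_left₀ hy0] at this
    · intro h u hu
      apply hψtriv
      rw [habsFmul]
      calc absF y * absF u ≤ q ^ (i : ℤ) * q ^ (-(i : ℤ)) := by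
            have := hFnn u
            gcongr
        _ = 1 := by rw [← zpow_add₀ hq0.ne']; simp
  have hchar : ∀ (i : ℕ) (y : F),
      ∫ u, (if absF u ≤ q ^ (-(i : ℤ)) then 1 else 0) * ψF (y * u) ∂μa =
        if absF y ≤ q ^ (i : ℤ) then ((q ^ (-(i : ℤ)) : ℝ) : ℂ) else 0 := by
    intro i y
    rw [aux_char absF habsFadd habsneg habsFmeas hFmulmeas hFaddmeas μa hμaadd ψF hψmeas hψadd
      _ y (by by_contra! h; obtain ⟨⟨u, h1, h2⟩, h3⟩ := h; exact h2 (h3 u h1)), hvol]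
    simp only [htriv]
  have hhat : ∀ x y : F, FHat μa ψF (PhiN q absF (n : ℤ)) (x, y) =
      ((q ^ (-(n : ℤ)) : ℝ) : ℂ) * if absF x ≤ 1 ∧ absF y ≤ q ^ (n : ℤ) then 1 else 0 := by
    intro x y
    have h1 := hchar n y
    have h2 := hchar 0 (-x)
    simp only [Nat.cast_zero, neg_zero, zpow_zero, habsneg] at h2
    unfold FHat PhiN
    have : ∀ w : F × F, (if absF w.1 ≤ q ^ (-(n : ℤ)) ∧ absF w.2 ≤ 1 then (1 : ℂ) else 0) *
        ψF (y * w.1 - x * w.2) =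
        ((if absF w.1 ≤ q ^ (-(n : ℤ)) then 1 else 0) * ψF (y * w.1)) *
        ((if absF w.2 ≤ 1 then 1 else 0) * ψF (-x * w.2)) := by
      intro w
      rw [sub_eq_add_neg, ← neg_mul, hψadd]
      by_cases ha : absF w.1 ≤ q ^ (-(n : ℤ)) <;> by_cases hb : absF w.2 ≤ 1 <;> simp [ha, hb]
    simp only [this]
    rw [integral_prod_mul (fun u => (if absF u ≤ q ^ (-(n : ℤ)) then 1 else 0) * ψF (y * u))
      (fun v => (if absF v ≤ 1 then 1 else 0) * ψF (-x * v)), h1, h2]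
    by_cases ha : absF x ≤ 1 <;> by_cases hb : absF y ≤ q ^ (n : ℤ) <;> simp [ha, hb]
  have hε0 : sqrtε ≠ 0 := by
    intro h
    apply hεnonsq 0
    apply (algebraMap F E).injective
    rw [← hsqrtε, h]; simp
  have hεE : absE sqrtε = 1 := by
    have := habsEspan 0 1
    simpa [hF0, habs1] using this
  obtain ⟨hkH, hka, hkd, hkb, hkc⟩ := hk
  obtain ⟨hrel, β, h₁, hdec, hc1, hd1⟩ := aux_decomp σ hσadd hσmul hσinvol hσfix sqrtε hε0
    hσsqrtε hspan k hkH
  have hc1a := congrArg absE hc1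
  have hd1a := congrArg absE hd1
  rw [habsEF, habsEmul, habsEmul, habsEconj, hεE, mul_one] at hc1a
  rw [habsEF, habsEmul, habsEconj] at hd1a
  have hβ := hEpos β hdec.1
  set N : ℝ := q ^ n with hN
  have hNpos : 0 < N := by positivity
  have hz1 : (q ^ 2) ^ (n : ℤ) = N ^ 2 := by
    rw [zpow_natCast, ← pow_mul, hN, ← pow_mul, mul_comm]
  rw [hz1] at hkb
  rw [_root_.zpow_neg, hz1] at hkc
  have h1E : absE 1 = 1 := by
    have := habsEF 1
    simpa [habs1] using this
  have hlow : absE (k 1 1) = 1 ∨ absE (k 1 0) = (N ^ 2)⁻¹ := by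
    have h := habsEadd (σ (k 0 0) * k 1 1) (σ (k 1 0) * k 0 1)
    rw [hrel, h1E, habsEmul, habsEmul, habsEconj, habsEconj] at h
    rcases le_max_iff.1 h with h | h
    · left
      apply le_antisymm hkd
      exact h.trans (mul_le_of_le_one_left (hEnn _) hka)
    · right
      apply le_antisymm hkc
      rw [inv_le_iff_one_le_mul₀ (by positivity)]
      exact h.trans (mul_le_mul_of_nonneg_left hkb (hEnn _))
  -- the common size
  obtain ⟨m, hm⟩ : ∃ m : ℤ, absE β = (q ^ m) ^ 2 := by
    obtain ⟨m, hm⟩ := hvalE β hdec.1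
    exact ⟨m, by rw [hm, ← zpow_natCast, ← zpow_natCast, ← _root_.zpow_mul, ← _root_.zpow_mul, mul_comm]⟩
  have hQ : 0 < q ^ m := by positivity
  have hiff : ∀ r : F, (absF (r * h₁ 1 0) ≤ 1 ∧ absF (r * h₁ 1 1) ≤ q ^ (n : ℤ)) ↔
      absF r ≤ q ^ ((n : ℤ) - m) := by
    intro r
    have hr := hFnn r
    rw [zpow_sub₀ hq0.ne', zpow_natCast, ← hN, habsFmul, habsFmul,
      ← sq_le_sq₀ (by have := hFnn (h₁ 1 0); positivity) zero_le_one,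
      ← sq_le_sq₀ (by have := hFnn (h₁ 1 1); positivity) hNpos.le,
      ← sq_le_sq₀ hr (by positivity), mul_pow, mul_pow, hc1a, hd1a, div_pow, ← hm,
      le_div_iff₀ hβ]
    constructor
    · rintro ⟨h2, h3⟩
      rcases hlow with h | h
      · rw [h] at h3; linarith
      · rw [h] at h2
        field_simp at h2
        linarith
    · intro h
      have hX : 0 ≤ absF r ^ 2 * absE β := by positivity
      constructor
      · calc absF r ^ 2 * (absE β * absE (k 1 0)) = (absF r ^ 2 * absE β) * absE (k 1 0) := by ring
          _ ≤ N ^ 2 * (N ^ 2)⁻¹ := mul_le_mul h hkc (hEnn _) (by positivity)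
          _ = 1 ^ 2 := by field_simp
      · calc absF r ^ 2 * (absE β * absE (k 1 1)) = (absF r ^ 2 * absE β) * absE (k 1 1) := by ring
          _ ≤ N ^ 2 * 1 := mul_le_mul h hkd (hEnn _) (by positivity)
          _ = N ^ 2 := by ring
  have hs' : 0 < (1 - s).re := by simp; linarith
  have hz := aux_zeta q hq absF habsF0 habsFmul ϖ hϖ hvalF habsFmeas hFmulmeas μ hμinv hμ1
    ((n : ℤ) - m) (1 - s) hs'
  rw [hfE _ _ _ β h₁ hdec]
  unfold zInt
  simp only [hhat, hiff, mul_assoc]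
  rw [integral_const_mul, hz, ← mul_assoc, ← mul_assoc]
  congr 1
  rw [mul_right_comm, ← Complex.mul_cpow_ofReal_nonneg hβ.le (by positivity), ← Complex.ofReal_mul]
  have e : absE β * (q ^ ((n : ℤ) - m)) ^ 2 = q ^ (2 * n) := by
    rw [hm, zpow_sub₀ hq0.ne', zpow_natCast, pow_mul']
    field_simp
  have hqc : (q : ℂ) ≠ 0 := by exact_mod_cast hq0.ne'
  have hx : ((q ^ (2 * n) : ℝ) : ℂ) ≠ 0 := by
    have : q ^ (2 * n) ≠ 0 := by positivity
    exact_mod_cast this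
  have hl : Complex.log ((q ^ (2 * n) : ℝ) : ℂ) = (2 * n) * Complex.log q := by
    rw [← Complex.ofReal_log (by positivity), ← Complex.ofReal_log hq0.le, Real.log_pow]
    push_cast; ring
  have hqn : ((q ^ (-(n : ℤ)) : ℝ) : ℂ) = (q : ℂ) ^ (-(n : ℂ)) := by
    rw [Complex.cpow_neg, Complex.cpow_natCast, _root_.zpow_neg, zpow_natCast]
    push_cast; rfl
  rw [e, hqn, Complex.cpow_def_of_ne_zero hx, hl, Complex.cpow_def_of_ne_zero hqc,
    Complex.cpow_def_of_ne_zero hqc, ← Complex.exp_add]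
  congr 1
  ring
end
end
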